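/- Let Ω ⊆ ℝ² be open, let N : Ω → ℝ³ be C² with ‖N(p)‖ = 1 for all p, and let g : Ω → ℝ³ be C² satisfying g_x = N × N_y − N_x and g_y = −N × N_x − N_y on Ω. Then on all of Ω: ⟨g_x, N⟩ = ⟨g_y, N⟩ = 0, ⟨g_x, g_y⟩ = 0, and ⟨g_x, g_x⟩ = ⟨g_y, g_y⟩ = ‖N_x‖² + ‖N_y‖² + 2⟨N, N_x × N_y⟩ (so g is conformally parameterized); moreover, at every point where g is an immersion, the mean curvature of g with respect to the unit normal N equals 1/2. -/

import Mathlib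

noncomputable section

open Real

/-- Euclidean dot product on `ℝ³`. -/
def dot3 (u v : Fin 3 → ℝ) : ℝ := u 0 * v 0 + u 1 * v 1 + u 2 * v 2

/-- Cross product on `ℝ³`. -/
def cross3 (u v : Fin 3 → ℝ) : Fin 3 → ℝ :=
  ![u 1 * v 2 - u 2 * v 1, u 2 * v 0 - u 0 * v 2, u 0 * v 1 - u 1 * v 0]

/-- Euclidean norm on `ℝ³`. -/
def norm3 (u : Fin 3 → ℝ) : ℝ := Real.sqrt (dot3 u u)

/-- Partial derivative in the first (x) coordinate direction. -/
def px (f : ℝ × ℝ → Fin 3 → ℝ) (p : ℝ × ℝ) : Fin 3 → ℝ := fderiv ℝ f p (1, 0)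

/-- Partial derivative in the second (y) coordinate direction. -/
def py (f : ℝ × ℝ → Fin 3 → ℝ) (p : ℝ × ℝ) : Fin 3 → ℝ := fderiv ℝ f p (0, 1)

/-- Gauss curvature of `g` with respect to the unit normal field `ν`:
`K = (l·n − m²)/(E·G − F²)`. -/
def GaussK (g ν : ℝ × ℝ → Fin 3 → ℝ) (p : ℝ × ℝ) : ℝ :=
  (dot3 (px (px g) p) (ν p) * dot3 (py (py g) p) (ν p) - dot3 (py (px g) p) (ν p) ^ 2) /
    (dot3 (px g p) (px g p) * dot3 (py g p) (py g p) - dot3 (px g p) (py g p) ^ 2)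

/-- Mean curvature of `g` with respect to the unit normal field `ν`:
`H = (E·n − 2F·m + G·l)/(2(E·G − F²))`. -/
def MeanH (g ν : ℝ × ℝ → Fin 3 → ℝ) (p : ℝ × ℝ) : ℝ :=
  (dot3 (px g p) (px g p) * dot3 (py (py g) p) (ν p)
      - 2 * dot3 (px g p) (py g p) * dot3 (py (px g) p) (ν p)
      + dot3 (py g p) (py g p) * dot3 (px (px g) p) (ν p)) /
    (2 * (dot3 (px g p) (px g p) * dot3 (py g p) (py g p) - dot3 (px g p) (py g p) ^ 2))

/-- Product rule for a pair of fields whose Euclidean dot product is constant on an open set. -/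
lemma dot3_fderiv_add_eq_zero {Ω : Set (ℝ × ℝ)} (hΩ : IsOpen Ω) {f h : ℝ × ℝ → Fin 3 → ℝ} {c : ℝ}
    (hc : ∀ q ∈ Ω, dot3 (f q) (h q) = c) {p : ℝ × ℝ} (hp : p ∈ Ω)
    (hf : DifferentiableAt ℝ f p) (hh : DifferentiableAt ℝ h p) (v : ℝ × ℝ) :
    dot3 (fderiv ℝ f p v) (h p) + dot3 (f p) (fderiv ℝ h p v) = 0 := by
  have hf' := hasFDerivAt_pi'.1 hf.hasFDerivAt
  have hh' := hasFDerivAt_pi'.1 hh.hasFDerivAt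
  have hD := (((hf' 0).mul (hh' 0)).add ((hf' 1).mul (hh' 1))).add ((hf' 2).mul (hh' 2))
  have hconst : HasFDerivAt (fun q => dot3 (f q) (h q)) (0 : ℝ × ℝ →L[ℝ] ℝ) p :=
    (hasFDerivAt_const c p).congr_of_eventuallyEq
      (Filter.eventually_of_mem (hΩ.mem_nhds hp) hc)
  have hv := DFunLike.congr_fun (hD.unique hconst) v
  simp at hv
  simp only [dot3]
  linear_combination hv

lemma dot3_self_of_norm3_eq_one {u : Fin 3 → ℝ} (hu : norm3 u = 1) : dot3 u u = 1 :=
  Real.sqrt_eq_one.1 hu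

lemma dot3_comm (u v : Fin 3 → ℝ) : dot3 u v = dot3 v u := by
  simp only [dot3]; ring

lemma eq_zero_of_dot3_self_eq_zero {u : Fin 3 → ℝ} (hu : dot3 u u = 0) : u = 0 := by
  simp only [dot3] at hu
  ext i
  fin_cases i <;> simp <;> nlinarith [sq_nonneg (u 0), sq_nonneg (u 1), sq_nonneg (u 2)]

lemma differentiableAt_fderiv_apply {Ω : Set (ℝ × ℝ)} (hΩ : IsOpen Ω) {g : ℝ × ℝ → Fin 3 → ℝ}
    (hg : ContDiffOn ℝ 2 g Ω) {p : ℝ × ℝ} (hp : p ∈ Ω) (v : ℝ × ℝ) :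
    DifferentiableAt ℝ (fun q => fderiv ℝ g q v) p :=
  ((((hg.contDiffAt (hΩ.mem_nhds hp)).fderiv_right (m := 1) (by norm_num)).differentiableAt
    one_ne_zero)).clm_apply (differentiableAt_const v)

/-- the parallel CMC map `g` with `g_x = N × N_y − N_x`, `g_y = −N × N_x − N_y`
is conformal, orthogonal to `N`, and has mean curvature `1/2` at immersed points. -/
theorem stmt9 (Ω : Set (ℝ × ℝ)) (hΩ : IsOpen Ω)
    (N g : ℝ × ℝ → Fin 3 → ℝ)
    (hN : ContDiffOn ℝ 2 N Ω) (hg : ContDiffOn ℝ 2 g Ω)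
    (hunit : ∀ p ∈ Ω, norm3 (N p) = 1)
    (heq : ∀ p ∈ Ω, px g p = cross3 (N p) (py N p) - px N p ∧
      py g p = -(cross3 (N p) (px N p)) - py N p) :
    ∀ p ∈ Ω,
      dot3 (px g p) (N p) = 0 ∧ dot3 (py g p) (N p) = 0 ∧
      dot3 (px g p) (py g p) = 0 ∧
      dot3 (px g p) (px g p) =
        dot3 (px N p) (px N p) + dot3 (py N p) (py N p)
          + 2 * dot3 (N p) (cross3 (px N p) (py N p)) ∧
      dot3 (py g p) (py g p) =
        dot3 (px N p) (px N p) + dot3 (py N p) (py N p)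
          + 2 * dot3 (N p) (cross3 (px N p) (py N p)) ∧
      (cross3 (px g p) (py g p) ≠ 0 → MeanH g N p = 1 / 2) := by
  have hNdiff : ∀ p ∈ Ω, DifferentiableAt ℝ N p := fun p hp =>
    (hN.contDiffAt (hΩ.mem_nhds hp)).differentiableAt two_ne_zero
  have hNN : ∀ p ∈ Ω, dot3 (N p) (N p) = 1 := fun p hp => dot3_self_of_norm3_eq_one (hunit p hp)
  have hNtangent : ∀ p ∈ Ω, ∀ v, dot3 (N p) (fderiv ℝ N p v) = 0 := fun p hp v => by
    have h := dot3_fderiv_add_eq_zero hΩ hNN hp (hNdiff p hp) (hNdiff p hp) v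
    rw [dot3_comm (fderiv ℝ N p v)] at h
    linarith
  have hNx : ∀ p ∈ Ω, dot3 (N p) (px N p) = 0 := fun p hp => hNtangent p hp _
  have hNy : ∀ p ∈ Ω, dot3 (N p) (py N p) = 0 := fun p hp => hNtangent p hp _
  have hgxN : ∀ p ∈ Ω, dot3 (px g p) (N p) = 0 := fun p hp => by
    have h := hNx p hp
    rw [(heq p hp).1]
    simp [dot3, cross3] at h ⊢
    linear_combination -h
  have hgyN : ∀ p ∈ Ω, dot3 (py g p) (N p) = 0 := fun p hp => by
    have h := hNy p hp
    rw [(heq p hp).2]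
    simp [dot3, cross3] at h ⊢
    linear_combination -h
  intro p hp
  have h1 := hNN p hp
  have ha := hNx p hp
  have hb := hNy p hp
  have hF : dot3 (px g p) (py g p) = 0 := by
    rw [(heq p hp).1, (heq p hp).2]
    have e : dot3 (cross3 (N p) (py N p) - px N p) (-(cross3 (N p) (px N p)) - py N p) =
        (1 - dot3 (N p) (N p)) * dot3 (px N p) (py N p) +
          dot3 (N p) (px N p) * dot3 (N p) (py N p) := by
      simp [dot3, cross3]; ring
    rw [e, h1, ha]; ring
  have hE : dot3 (px g p) (px g p) = dot3 (px N p) (px N p) + dot3 (py N p) (py N p)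
      + 2 * dot3 (N p) (cross3 (px N p) (py N p)) := by
    rw [(heq p hp).1]
    have e : dot3 (cross3 (N p) (py N p) - px N p) (cross3 (N p) (py N p) - px N p) =
        dot3 (N p) (N p) * dot3 (py N p) (py N p) - dot3 (N p) (py N p) ^ 2 +
          dot3 (px N p) (px N p) + 2 * dot3 (N p) (cross3 (px N p) (py N p)) := by
      simp [dot3, cross3]; ring
    rw [e, h1, hb]; ring
  have hG : dot3 (py g p) (py g p) = dot3 (px N p) (px N p) + dot3 (py N p) (py N p)
      + 2 * dot3 (N p) (cross3 (px N p) (py N p)) := by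
    rw [(heq p hp).2]
    have e : dot3 (-(cross3 (N p) (px N p)) - py N p) (-(cross3 (N p) (px N p)) - py N p) =
        dot3 (N p) (N p) * dot3 (px N p) (px N p) - dot3 (N p) (px N p) ^ 2 +
          dot3 (py N p) (py N p) + 2 * dot3 (N p) (cross3 (px N p) (py N p)) := by
      simp [dot3, cross3]; ring
    rw [e, h1, ha]; ring
  refine ⟨hgxN p hp, hgyN p hp, hF, hE, hG, fun himm => ?_⟩
  have hE0 : dot3 (px g p) (px g p) ≠ 0 := fun h0 => himm <| by
    rw [eq_zero_of_dot3_self_eq_zero h0]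
    ext i
    fin_cases i <;> simp [cross3]
  have hl : dot3 (px (px g) p) (N p) + dot3 (px g p) (px N p) = 0 :=
    dot3_fderiv_add_eq_zero hΩ hgxN hp (differentiableAt_fderiv_apply hΩ hg hp _) (hNdiff p hp) _
  have hn : dot3 (py (py g) p) (N p) + dot3 (py g p) (py N p) = 0 :=
    dot3_fderiv_add_eq_zero hΩ hgyN hp (differentiableAt_fderiv_apply hΩ hg hp _) (hNdiff p hp) _
  have htrace : dot3 (px g p) (px N p) + dot3 (py g p) (py N p) = -dot3 (px g p) (px g p) := by
    rw [hE, (heq p hp).1, (heq p hp).2]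
    simp [dot3, cross3]; ring
  have hln : dot3 (py (py g) p) (N p) = dot3 (px g p) (px g p) - dot3 (px (px g) p) (N p) := by
    linear_combination hl + hn - htrace
  rw [MeanH, hF, hG.trans hE.symm, hln]
  field_simp
  ring
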